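/- Let D be an almost Dedekind domain and fix n ∈ ℕ. Then the following are equivalent: (i) Crit^n(D) = ∅; (ii) every nonzero finitely generated proper ideal of D is a finite product of n-bounded ideals. -/

import Mathlib

/-!
Common definitions: almost Dedekind domains, ideal functions, critical ideals,
the constructible topology on the maximal spectrum.
-/

open scoped Classical Topology

namespace ADPaper

variable (R : Type*) [CommRing R]

/-- The normalized valuation `v_M(x)` of an element `x` of `R` in the localization at the
maximal ideal `M`: the largest `n` such that the image of `x` lies in the `n`-th power of the
maximal ideal of `R_M` (a junk value if no largest such `n` exists). -/
noncomputable def elemVal (M : MaximalSpectrum R) (x : R) : ℕ :=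
  sSup {n : ℕ | algebraMap R (Localization.AtPrime M.asIdeal) x ∈
    IsLocalRing.maximalIdeal (Localization.AtPrime M.asIdeal) ^ n}

/-- The ideal function `ν_I(M) = v_M(I) = min { v_M(x) : x ∈ I, x ≠ 0 }`. -/
noncomputable def nu (I : Ideal R) (M : MaximalSpectrum R) : ℕ :=
  sInf (elemVal R M '' {x | x ∈ I ∧ x ≠ 0})

/-- `R` is an almost Dedekind domain: the localization at every maximal ideal is a
discrete valuation ring. (The requirement that `R` is not a field is stated separately
where needed.) -/
def AlmostDedekind [IsDomain R] : Prop :=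
  ∀ M : MaximalSpectrum R, IsDiscreteValuationRing (Localization.AtPrime M.asIdeal)

/-- An ideal `M` of a commutative ring is critical if it is maximal and contains no nonzero
finitely generated radical ideal. -/
def IsCritical (M : Ideal R) : Prop :=
  M.IsMaximal ∧ ∀ J : Ideal R, J ≠ ⊥ → J.FG → J.IsRadical → ¬ J ≤ M

/-- `Crit R`: the set of critical maximal ideals, i.e. maximal ideals containing no
nonzero finitely generated radical ideal. -/
def Crit : Set (MaximalSpectrum R) :=
  {M | ∀ J : Ideal R, J ≠ ⊥ → J.FG → J.IsRadical → ¬ J ≤ M.asIdeal}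

/-- `CritN R n`: the set of `n`-critical maximal ideals, i.e. maximal ideals containing no
nonzero finitely generated ideal whose ideal function is bounded by `n`. -/
def CritN (n : ℕ) : Set (MaximalSpectrum R) :=
  {M | ∀ J : Ideal R, J ≠ ⊥ → J.FG → (∀ N, nu R J N ≤ n) → ¬ J ≤ M.asIdeal}

/-- `CritOmega R`: the set of `ω`-critical maximal ideals, i.e. maximal ideals containing no
nonzero finitely generated ideal whose ideal function is bounded. -/
def CritOmega : Set (MaximalSpectrum R) :=
  {M | ∀ J : Ideal R, J ≠ ⊥ → J.FG → (∃ n : ℕ, ∀ N, nu R J N ≤ n) → ¬ J ≤ M.asIdeal}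

/-- The constructible topology on the maximal spectrum: generated by the sets
`V(J) = {M | J ≤ M}` and their complements, for `J` finitely generated. -/
def constrTop : TopologicalSpace (MaximalSpectrum R) :=
  TopologicalSpace.generateFrom
    {S | ∃ J : Ideal R, J.FG ∧ (S = {M | J ≤ M.asIdeal} ∨ S = {M | ¬ J ≤ M.asIdeal})}

variable [IsDomain R]

/-- The localization `R_M` regarded as a subalgebra of the fraction field. -/
noncomputable def locSubalgebra (M : MaximalSpectrum R) : Subalgebra R (FractionRing R) :=
  Localization.subalgebra (FractionRing R) M.asIdeal.primeCompl
    (fun _s hs => mem_nonZeroDivisors_of_ne_zero fun h => hs (h ▸ M.asIdeal.zero_mem))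

/-- The overring `⋂ {R_M : M ∈ X}` of `R` inside the fraction field (equal to the whole
fraction field when `X = ∅`). -/
noncomputable def interLoc (X : Set (MaximalSpectrum R)) : Subalgebra R (FractionRing R) :=
  ⨅ M ∈ X, locSubalgebra R M

/-- The valuation `v_M` extended to the fraction field: `v_M(a/s) = v_M(a) - v_M(s)`. -/
noncomputable def elemValK (M : MaximalSpectrum R) (x : FractionRing R) : ℤ :=
  (elemVal R M (IsLocalization.sec (nonZeroDivisors R) x).1 : ℤ) -
    (elemVal R M ((IsLocalization.sec (nonZeroDivisors R) x).2 : R) : ℤ)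

/-- The ideal function of a fractional ideal. -/
noncomputable def nuK (I : FractionalIdeal (nonZeroDivisors R) (FractionRing R))
    (M : MaximalSpectrum R) : ℤ :=
  sInf (elemValK R M '' {x | x ∈ I ∧ x ≠ 0})

end ADPaper

namespace ADPaper

/-- The ideal function is antitone on nonzero ideals. -/
theorem nu_le_nu_of_le {R : Type*} [CommRing R] {I J : Ideal R} (hI : I ≠ ⊥) (h : I ≤ J)
    (M : MaximalSpectrum R) : nu R J M ≤ nu R I M := by
  obtain ⟨x, hx, hx0⟩ := Submodule.exists_mem_ne_zero_of_ne_bot hI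
  exact csInf_le_csInf (OrderBot.bddBelow _) ⟨_, x, ⟨hx, hx0⟩, rfl⟩
    (Set.image_mono fun y hy => ⟨h hy.1, hy.2⟩)

/-- A finitely generated ideal of a ring which is a valuation ring locally at `M` is, locally
at `M`, generated by one of its elements. -/
theorem exists_mul_mem_span_singleton {R : Type*} [CommRing R] (M : Ideal R) [M.IsPrime]
    [PreValuationRing (Localization.AtPrime M)] {I : Ideal R} (hI : I.FG) :
    ∃ x ∈ I, ∃ s ∉ M, ∀ a ∈ I, s * a ∈ Ideal.span {x} := by
  have total : ∀ a b : R, (∃ s ∉ M, a ∣ s * b) ∨ ∃ s ∉ M, b ∣ s * a := by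
    have key : ∀ a b : R, algebraMap R (Localization.AtPrime M) a ∣ algebraMap R _ b →
        ∃ s ∉ M, a ∣ s * b := by
      rintro a b ⟨c, hc⟩
      obtain ⟨⟨r, s⟩, hrs⟩ := IsLocalization.surj M.primeCompl c
      have h : algebraMap R (Localization.AtPrime M) (s * b) = algebraMap R _ (a * r) := by
        rw [map_mul, map_mul, hc, ← hrs]
        ring
      obtain ⟨t, ht⟩ := (IsLocalization.eq_iff_exists M.primeCompl _).1 h
      exact ⟨t * s, (t * s).2, t * r, by rw [mul_assoc, ht]; ring⟩
    intro a b
    exact (ValuationRing.dvd_total (algebraMap R (Localization.AtPrime M) a)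
      (algebraMap R _ b)).imp (key a b) (key b a)
  have sup : ∀ (I₁ I₂ : Ideal R) (x₁ x₂ s₁ s₂ s : R), s₁ ∉ M → s₂ ∉ M → s ∉ M → x₁ ∈ I₁ →
      (∀ a ∈ I₁, s₁ * a ∈ Ideal.span {x₁}) → (∀ a ∈ I₂, s₂ * a ∈ Ideal.span {x₂}) →
      x₁ ∣ s * x₂ → ∃ x ∈ I₁ ⊔ I₂, ∃ s ∉ M, ∀ a ∈ I₁ ⊔ I₂, s * a ∈ Ideal.span {x} := by
    intro I₁ I₂ x₁ x₂ s₁ s₂ s hs₁ hs₂ hs hx₁ h₁ h₂ hd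
    refine ⟨x₁, Ideal.mem_sup_left hx₁, s * s₁ * s₂, ?_, fun a ha => ?_⟩
    · exact M.primeCompl.mul_mem (M.primeCompl.mul_mem hs hs₁) hs₂
    · obtain ⟨u, hu, v, hv, rfl⟩ := Submodule.mem_sup.1 ha
      have hu' := Ideal.mem_span_singleton.1 (h₁ u hu)
      have hv' := hd.trans (mul_dvd_mul_left s (Ideal.mem_span_singleton.1 (h₂ v hv)))
      rw [Ideal.mem_span_singleton, show s * s₁ * s₂ * (u + v) =
        (s * s₂) * (s₁ * u) + s₁ * (s * (s₂ * v)) by ring]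
      exact dvd_add (hu'.mul_left _) (hv'.mul_left _)
  induction I, hI using Submodule.fg_induction with
  | singleton x =>
    exact ⟨x, Submodule.mem_span_singleton_self x, 1, Ideal.one_notMem M,
      fun a ha => by simpa using ha⟩
  | sup I₁ I₂ _ _ ih₁ ih₂ =>
    obtain ⟨x₁, hx₁, s₁, hs₁, h₁⟩ := ih₁
    obtain ⟨x₂, hx₂, s₂, hs₂, h₂⟩ := ih₂
    rcases total x₁ x₂ with ⟨s, hs, hd⟩ | ⟨s, hs, hd⟩
    · exact sup I₁ I₂ x₁ x₂ s₁ s₂ s hs₁ hs₂ hs hx₁ h₁ h₂ hd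
    · rw [sup_comm]
      exact sup I₂ I₁ x₂ x₁ s₂ s₁ s hs₂ hs₁ hs hx₂ h₂ h₁ hd

section AlmostDedekind

variable {R : Type*} [CommRing R] [IsDomain R]

/-- A nonzero finitely generated ideal of an almost Dedekind domain divides each of the
principal ideals that it contains. -/
theorem AlmostDedekind.dvd_span_singleton (hAD : AlmostDedekind R) {I : Ideal R} (hI : I.FG)
    (hI0 : I ≠ ⊥) {y : R} (hy : y ∈ I) : I ∣ Ideal.span {y} := by
  set K : Ideal R := (Ideal.span {y}).colon (I : Set R)
  refine ⟨K, le_antisymm ?_ ?_⟩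
  · rw [Ideal.span_singleton_le_iff_mem]
    by_contra hmem
    have hne : (I * K).colon ({y} : Set R) ≠ ⊤ := fun h => hmem <| by
      have h1 : (1 : R) ∈ (I * K).colon ({y} : Set R) := h ▸ Submodule.mem_top
      simpa using Submodule.mem_colon_singleton.1 h1
    obtain ⟨M, hM, hle⟩ := Ideal.exists_le_maximal _ hne
    have : IsDiscreteValuationRing (Localization.AtPrime M) := hAD ⟨M, hM⟩
    obtain ⟨x, hx, s, hs, h⟩ := exists_mul_mem_span_singleton M hI
    have hx0 : x ≠ 0 := by
      rintro rfl
      obtain ⟨z, hz, hz0⟩ := Submodule.exists_mem_ne_zero_of_ne_bot hI0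
      have hsz := h z hz
      rw [Ideal.mem_span_singleton, zero_dvd_iff, mul_eq_zero] at hsz
      exact hs ((hsz.resolve_right hz0) ▸ M.zero_mem)
    obtain ⟨r, hr⟩ := Ideal.mem_span_singleton.1 (h y hy)
    refine hs (hle (Submodule.mem_colon_singleton.2 ?_))
    rw [smul_eq_mul, hr]
    refine Ideal.mul_mem_mul hx (Submodule.mem_colon.2 fun a ha => ?_)
    obtain ⟨c, hc⟩ := Ideal.mem_span_singleton.1 (h a ha)
    refine Ideal.mem_span_singleton.2 ⟨c, mul_left_cancel₀ hx0 ?_⟩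
    rw [smul_eq_mul]
    linear_combination y * hc - a * hr
  · exact Ideal.mul_le.2 fun a ha r hr => mul_comm r a ▸ Submodule.mem_colon.1 hr a ha

/-- A divisor of a nonzero principal ideal of a domain is finitely generated. -/
theorem fg_of_dvd_span_singleton {I : Ideal R} {y : R} (hy : y ≠ 0)
    (h : I ∣ Ideal.span {y}) : I.FG := by
  obtain ⟨K, hK⟩ := h
  refine Ideal.fg_of_isUnit (S := nonZeroDivisors R) (P := FractionRing R)
    (IsFractionRing.injective R (FractionRing R)) I ?_
  refine isUnit_of_mul_isUnit_left (y := (K : FractionalIdeal _ (FractionRing R))) ?_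
  rw [← FractionalIdeal.coeIdeal_mul, ← hK, FractionalIdeal.coeIdeal_span_singleton]
  refine IsUnit.of_mul_eq_one
    (FractionalIdeal.spanSingleton _ (algebraMap R (FractionRing R) y)⁻¹) ?_
  rw [FractionalIdeal.spanSingleton_mul_spanSingleton, mul_inv_cancel₀,
    FractionalIdeal.spanSingleton_one]
  exact (map_ne_zero_iff _ (IsFractionRing.injective R (FractionRing R))).2 hy

/-- A divisor of a nonzero finitely generated ideal of an almost Dedekind domain is finitely
generated. -/
theorem AlmostDedekind.fg_of_dvd (hAD : AlmostDedekind R) {I K : Ideal R} (hI : I.FG)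
    (hI0 : I ≠ ⊥) (h : K ∣ I) : K.FG := by
  obtain ⟨y, hy, hy0⟩ := Submodule.exists_mem_ne_zero_of_ne_bot hI0
  exact fg_of_dvd_span_singleton hy0 (h.trans (hAD.dvd_span_singleton hI hI0 hy))

/-- Nonzero finitely generated ideals of an almost Dedekind domain can be cancelled. -/
theorem AlmostDedekind.le_of_mul_le_mul_left (hAD : AlmostDedekind R) {K A B : Ideal R}
    (hK : K.FG) (hK0 : K ≠ ⊥) (h : K * A ≤ K * B) : A ≤ B := by
  obtain ⟨y, hy, hy0⟩ := Submodule.exists_mem_ne_zero_of_ne_bot hK0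
  obtain ⟨L, hL⟩ := hAD.dvd_span_singleton hK hK0 hy
  rw [← Ideal.span_singleton_mul_right_mono hy0, hL, mul_comm K L, mul_assoc, mul_assoc]
  exact Ideal.mul_mono_right h

/-- For nonzero finitely generated ideals of an almost Dedekind domain, to contain is to
divide. -/
theorem AlmostDedekind.dvd_of_le (hAD : AlmostDedekind R) {I K : Ideal R}
    (hK : K.FG) (hK0 : K ≠ ⊥) (h : I ≤ K) : K ∣ I := by
  obtain ⟨y, hy, hy0⟩ := Submodule.exists_mem_ne_zero_of_ne_bot hK0
  obtain ⟨L, hL⟩ := hAD.dvd_span_singleton hK hK0 hy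
  -- `C` is the ideal `y⁻¹ * (L * I)`
  set C : Ideal R := (L * I).colon ({y} : Set R)
  have hle : L * I ≤ Ideal.span {y} := by
    rw [hL, mul_comm]
    exact Ideal.mul_mono_left h
  have hC : L * I = Ideal.span {y} * C := by
    refine (Ideal.eq_span_singleton_mul _ _).2 ⟨fun z hz => ?_, fun z hz => ?_⟩
    · obtain ⟨c, rfl⟩ := Ideal.mem_span_singleton.1 (hle hz)
      exact ⟨c, Submodule.mem_colon_singleton.2 (by rwa [smul_eq_mul, mul_comm c]), rfl⟩
    · exact mul_comm z y ▸ Submodule.mem_colon_singleton.1 hz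
  refine ⟨C, (Ideal.span_singleton_mul_right_inj hy0).1 ?_⟩
  rw [mul_left_comm, ← hC, hL, mul_assoc]

/-- Nonzero prime ideals of an almost Dedekind domain are maximal. -/
theorem AlmostDedekind.isMaximal_of_isPrime (hAD : AlmostDedekind R) {P : Ideal R}
    (hP : P.IsPrime) (hP0 : P ≠ ⊥) : P.IsMaximal := by
  obtain ⟨M, hM, hle⟩ := Ideal.exists_le_maximal P hP.ne_top
  have : IsDiscreteValuationRing (Localization.AtPrime M) := hAD ⟨M, hM⟩
  have hd : Disjoint (M.primeCompl : Set R) (P : Set R) :=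
    Set.disjoint_left.2 fun a ha haP => ha (hle haP)
  have hQ := IsLocalization.isPrime_of_isPrime_disjoint M.primeCompl
    (Localization.AtPrime M) P hP hd
  have hQ0 : P.map (algebraMap R (Localization.AtPrime M)) ≠ ⊥ := by
    rwa [Ne, Ideal.map_eq_bot_iff_of_injective
      (IsLocalization.injective _ M.primeCompl_le_nonZeroDivisors)]
  have hQM := IsLocalRing.eq_maximalIdeal (hQ.isMaximal hQ0)
  have hPM : P = M := by
    rw [← IsLocalization.under_map_of_isPrime_disjoint M.primeCompl
      (Localization.AtPrime M) hP hd, hQM]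
    exact IsLocalization.AtPrime.under_maximalIdeal (Localization.AtPrime M) M
  exact hPM ▸ hM

/-- If a nonzero finitely generated ideal `I` of an almost Dedekind domain contains a product of
`n`-bounded finitely generated ideals, then `I` is itself a product of `n`-bounded proper
ideals. -/
theorem AlmostDedekind.exists_prod_eq_of_prod_le (hAD : AlmostDedekind R) (n : ℕ)
    (l : List (Ideal R)) (hl : ∀ L ∈ l, L ≠ ⊥ ∧ L.FG ∧ ∀ M, nu R L M ≤ n)
    (I : Ideal R) (hI : I.FG) (hI0 : I ≠ ⊥) (h : l.prod ≤ I) :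
    ∃ l' : List (Ideal R), (∀ J ∈ l', J ≠ ⊥ ∧ J ≠ ⊤ ∧ ∀ M, nu R J M ≤ n) ∧ I = l'.prod := by
  induction l generalizing I with
  | nil => exact ⟨[], by simp, by simpa [Ideal.one_eq_top] using h⟩
  | cons L l ih =>
    obtain ⟨hL0, hLfg, hLn⟩ := hl L List.mem_cons_self
    have hK : (I ⊔ L).FG := Submodule.FG.sup hI hLfg
    have hK0 : I ⊔ L ≠ ⊥ := ne_bot_of_le_ne_bot hL0 le_sup_right
    obtain ⟨C, hC⟩ := hAD.dvd_of_le hK hK0 (le_sup_left : I ≤ I ⊔ L)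
    have hC0 : C ≠ ⊥ := by
      rintro rfl
      exact hI0 (hC.trans (Ideal.mul_bot _))
    have hle : l.prod ≤ C := by
      refine hAD.le_of_mul_le_mul_left hK hK0 ?_
      rw [← hC, Ideal.sup_mul]
      exact sup_le Ideal.mul_le_left (List.prod_cons (a := L) ▸ h)
    obtain ⟨l', hl', hCl'⟩ := ih (fun J hJ => hl J (List.mem_cons_of_mem _ hJ)) C
      (hAD.fg_of_dvd hI hI0 ⟨_, hC.trans (mul_comm _ _)⟩) hC0 hle
    by_cases htop : I ⊔ L = ⊤
    · refine ⟨l', hl', ?_⟩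
      rw [hC, htop, Ideal.top_mul, hCl']
    · refine ⟨(I ⊔ L) :: l', ?_, ?_⟩
      · rw [List.forall_mem_cons]
        exact ⟨⟨hK0, htop, fun M => (nu_le_nu_of_le hL0 le_sup_right M).trans (hLn M)⟩, hl'⟩
      · rw [List.prod_cons, ← hCl', ← hC]

/-- If every prime ideal containing `I` contains an ideal with property `p`, and all ideals with
property `p` are finitely generated, then `I` contains a finite product of such ideals. -/
theorem exists_list_prod_le {R : Type*} [CommRing R] (p : Ideal R → Prop)
    (hp : ∀ J, p J → J.FG) (I : Ideal R)
    (h : ∀ P : Ideal R, P.IsPrime → I ≤ P → ∃ J, p J ∧ J ≤ P) :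
    ∃ l : List (Ideal R), (∀ J ∈ l, p J) ∧ l.prod ≤ I := by
  have hoka : Ideal.IsOka fun A : Ideal R =>
      I ≤ A → ∃ l : List (Ideal R), (∀ J ∈ l, p J) ∧ l.prod ≤ A := by
    refine ⟨fun _ => ⟨[], by simp, le_top⟩, fun {A a} h₁ h₂ hIA => ?_⟩
    obtain ⟨l₁, hl₁, hle₁⟩ := h₁ (hIA.trans le_sup_left)
    obtain ⟨l₂, hl₂, hle₂⟩ := h₂ (hIA.trans Ideal.le_colon)
    refine ⟨l₁ ++ l₂, fun J hJ => (List.mem_append.1 hJ).elim (hl₁ J) (hl₂ J), ?_⟩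
    rw [List.prod_append]
    refine (Ideal.mul_mono hle₁ hle₂).trans ?_
    rw [Ideal.sup_mul]
    refine sup_le Ideal.mul_le_left (Ideal.span_singleton_mul_le_iff.2 fun z hz => ?_)
    exact mul_comm z a ▸ Ideal.mem_colon_span_singleton.1 hz
  refine hoka.forall_of_forall_prime' (fun C hC hchain A hA hs => ?_) (fun P hP hIP => ?_) I le_rfl
  · have hIA : ∀ B ∈ C, I ≤ B := fun B hB => (Classical.not_imp.1 (hC hB)).1
    obtain ⟨l, hl, hle⟩ := hs ((hIA A hA).trans (le_sSup hA))
    have hfg : l.prod.FG := by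
      clear hle
      induction l with
      | nil => exact ⟨{1}, by simp [Ideal.one_eq_top]⟩
      | cons J l ih =>
        rw [List.prod_cons]
        exact (hp J (hl J List.mem_cons_self)).mul
          (ih fun J hJ => hl J (List.mem_cons_of_mem _ hJ))
    obtain ⟨B, hB, hlB⟩ := (CompleteLattice.isCompactElement_iff_le_of_directed_sSup_le _ _).1
      ((Submodule.fg_iff_compact _).1 hfg) C ⟨A, hA⟩ hchain.directedOn hle
    exact ⟨B, hB, fun _ => ⟨l, hl, hlB⟩⟩
  · obtain ⟨J, hJ, hJP⟩ := h P hP hIP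
    exact ⟨[J], by simpa using hJ, by simpa using hJP⟩

end AlmostDedekind

/-- For an almost Dedekind domain `D` and `n ∈ ℕ`: `Critⁿ(D) = ∅` if and
only if every nonzero finitely generated proper ideal of `D` is a finite product of
`n`-bounded ideals. -/
theorem statement4 (R : Type*) [CommRing R] [IsDomain R] (hR : ¬ IsField R)
    (hAD : AlmostDedekind R) (n : ℕ) :
    CritN R n = ∅ ↔
      ∀ I : Ideal R, I.FG → I ≠ ⊥ → I ≠ ⊤ →
        ∃ (k : ℕ) (J : Fin k → Ideal R),
          (∀ i, J i ≠ ⊥ ∧ J i ≠ ⊤ ∧ ∀ M, nu R (J i) M ≤ n) ∧ I = ∏ i, J i := by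
  constructor
  · intro hcrit I hI hI0 _
    obtain ⟨l, hl, hle⟩ := exists_list_prod_le
      (fun J : Ideal R => J ≠ ⊥ ∧ J.FG ∧ ∀ M, nu R J M ≤ n) (fun J hJ => hJ.2.1) I
      fun P hP hIP => by
        have hM : (⟨P, hAD.isMaximal_of_isPrime hP (ne_bot_of_le_ne_bot hI0 hIP)⟩ :
            MaximalSpectrum R) ∉ CritN R n := by
          rw [hcrit]
          exact Set.notMem_empty _
        simp only [CritN, Set.mem_ofPred_eq, not_forall, not_not] at hM
        obtain ⟨J, hJ0, hJ, hJn, hJP⟩ := hM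
        exact ⟨J, ⟨hJ0, hJ, hJn⟩, hJP⟩
    obtain ⟨l', hl', hIl'⟩ := hAD.exists_prod_eq_of_prod_le n l hl I hI hI0 hle
    refine ⟨l'.length, l'.get, fun i => hl' _ (List.get_mem l' i), ?_⟩
    rw [hIl', ← List.prod_ofFn, List.ofFn_get]
  · intro h
    refine Set.eq_empty_of_forall_notMem fun M hM => ?_
    obtain ⟨x, hx, hx0⟩ := Submodule.exists_mem_ne_zero_of_ne_bot
      (Ring.ne_bot_of_isMaximal_of_not_isField M.isMaximal hR)
    have hxM : Ideal.span {x} ≤ M.asIdeal := (Ideal.span_singleton_le_iff_mem _).2 hx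
    have hx0' : Ideal.span {x} ≠ ⊥ := by simpa using hx0
    obtain ⟨k, J, hJ, hprod⟩ := h (Ideal.span {x}) ⟨{x}, by simp⟩ hx0'
      (ne_top_of_le_ne_top M.isMaximal.ne_top hxM)
    obtain ⟨i, -, hi⟩ := M.isMaximal.isPrime.prod_le.1 (hprod ▸ hxM)
    refine hM (J i) (hJ i).1 ?_ (hJ i).2.2 hi
    exact fg_of_dvd_span_singleton hx0 (hprod ▸ Finset.dvd_prod_of_mem J (Finset.mem_univ i))

end ADPaper
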